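/- arXiv:0908.2496 — 2 statements merged into one kernel-verified Lean document; each statement's English description precedes it below -/
import Mathlib

section
/- Let α, β be integers with 1 ≤ α, 1 ≤ β, α + β ≤ 7 and 2α + β ≠ 8, and let n ≥ 2. On a probability space, let A₁,…,Aₙ be independent events each of probability 1/2, and let r₁,…,rₙ be random variables such that rᵢ ∈ {α, 8−α} on Aᵢ and rᵢ ∈ {α+β, 8−(α+β)} on the complement of Aᵢ. Then the probability that the union over i of the sets {rᵢ, 8−rᵢ} differs from R = {α, 8−α, α+β, 8−(α+β)} equals 2/2ⁿ = 1/2^{n−1}. -/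
open MeasureTheory ProbabilityTheory

/-- The orbit of any element of `{a, 8 - a}` under `y ↦ 8 - y` is `{a, 8 - a}`. -/
lemma pair_eight_sub_eq {a x : ℤ} (h : x ∈ ({a, 8 - a} : Set ℤ)) :
    ({x, 8 - x} : Finset ℤ) = {a, 8 - a} := by
  rcases h with rfl | rfl
  · rfl
  · rw [sub_sub_cancel, Finset.pair_comm]

/-- A nonempty union of pairs, each equal to `{a, 8 - a}` or `{b, 8 - b}`, misses one of the two distinct
pairs exactly when only one kind occurs. -/
lemma biUnion_pair_ne_iff {ι : Type*} [Fintype ι] [Nonempty ι] {a b : ℤ} (hab : a ≠ b)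
    (hab' : a + b ≠ 8) (p : ι → Prop) (x : ι → ℤ)
    (h₁ : ∀ i, p i → x i ∈ ({a, 8 - a} : Set ℤ))
    (h₂ : ∀ i, ¬ p i → x i ∈ ({b, 8 - b} : Set ℤ)) :
    (Finset.univ.biUnion fun i => ({x i, 8 - x i} : Finset ℤ)) ≠ {a, 8 - a, b, 8 - b} ↔
      (∀ i, p i) ∨ ∀ i, ¬ p i := by
  have e₁ i (hi : p i) := pair_eight_sub_eq (h₁ i hi)
  have e₂ i (hi : ¬ p i) := pair_eight_sub_eq (h₂ i hi)
  constructor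
  · contrapose!
    rintro ⟨⟨j, hj⟩, k, hk⟩
    ext y
    simp only [Finset.mem_biUnion, Finset.mem_univ, true_and]
    constructor
    · rintro ⟨i, hy⟩
      by_cases hi : p i
      · rw [e₁ i hi] at hy
        simp only [Finset.mem_insert, Finset.mem_singleton] at hy ⊢
        tauto
      · rw [e₂ i hi] at hy
        simp only [Finset.mem_insert, Finset.mem_singleton] at hy ⊢
        tauto
    · intro hy
      have hy' : y ∈ ({a, 8 - a} : Finset ℤ) ∨ y ∈ ({b, 8 - b} : Finset ℤ) := by
        simp only [Finset.mem_insert, Finset.mem_singleton] at hy ⊢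
        tauto
      rcases hy' with hy' | hy'
      · exact ⟨k, by rwa [e₁ k hk]⟩
      · exact ⟨j, by rwa [e₂ j hj]⟩
  · rintro (h | h) heq
    · have hb : b ∈ Finset.univ.biUnion fun i => ({x i, 8 - x i} : Finset ℤ) := by
        simp [heq]
      obtain ⟨i, -, hi⟩ := Finset.mem_biUnion.1 hb
      rw [e₁ i (h i)] at hi
      simp only [Finset.mem_insert, Finset.mem_singleton] at hi
      omega
    · have ha : a ∈ Finset.univ.biUnion fun i => ({x i, 8 - x i} : Finset ℤ) := by
        simp [heq]
      obtain ⟨i, -, hi⟩ := Finset.mem_biUnion.1 ha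
      rw [e₂ i (h i)] at hi
      simp only [Finset.mem_insert, Finset.mem_singleton] at hi
      omega

lemma ProbabilityTheory.iIndepSet.measure_iInter_compl {Ω ι : Type*} [MeasurableSpace Ω]
    [Fintype ι] {μ : Measure Ω} {A : ι → Set Ω} (h : iIndepSet A μ) :
    μ (⋂ i, (A i)ᶜ) = ∏ i, μ (A i)ᶜ :=
  iIndep.meas_iInter h fun _ =>
    (MeasurableSpace.measurableSet_generateFrom (Set.mem_singleton _)).compl

/-- Yen et al.'s Proposition 1, probabilistic part: if `2α + β ≠ 8`, `n ≥ 2`, and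
`A₁,…,Aₙ` are independent events each of probability `1/2`, with `rᵢ ∈ {α, 8-α}` on `Aᵢ`
and `rᵢ ∈ {α+β, 8-(α+β)}` off `Aᵢ`, then the probability that
`⋃ i, {rᵢ, 8-rᵢ} ≠ R = {α, 8-α, α+β, 8-(α+β)}` equals `2/2ⁿ = 1/2^(n-1)`. -/
theorem prob_rotation_set_not_covered_half
    {Ω : Type*} [MeasurableSpace Ω] (μ : Measure Ω) [IsProbabilityMeasure μ]
    (α β : ℤ) (hα : 1 ≤ α) (hβ : 1 ≤ β) (hαβ : α + β ≤ 7) (h8 : 2 * α + β ≠ 8)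
    (n : ℕ) (hn : 2 ≤ n)
    (A : Fin n → Set Ω) (hAm : ∀ i, MeasurableSet (A i))
    (hAindep : iIndepSet A μ) (hAp : ∀ i, μ (A i) = 1 / 2)
    (r : Fin n → Ω → ℤ)
    (hr1 : ∀ i, ∀ ω ∈ A i, r i ω ∈ ({α, 8 - α} : Set ℤ))
    (hr2 : ∀ i, ∀ ω ∉ A i, r i ω ∈ ({α + β, 8 - (α + β)} : Set ℤ)) :
    μ {ω | (Finset.univ.biUnion fun i => ({r i ω, 8 - r i ω} : Finset ℤ)) ≠
        ({α, 8 - α, α + β, 8 - (α + β)} : Finset ℤ)} =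
      2 / 2 ^ n := by
  have : Nonempty (Fin n) := ⟨⟨0, by omega⟩⟩
  have hset : {ω | (Finset.univ.biUnion fun i => ({r i ω, 8 - r i ω} : Finset ℤ)) ≠
      ({α, 8 - α, α + β, 8 - (α + β)} : Finset ℤ)} = (⋂ i, A i) ∪ ⋂ i, (A i)ᶜ := by
    ext ω
    simpa using biUnion_pair_ne_iff (a := α) (b := α + β) (by omega) (by omega)
      (fun i => ω ∈ A i) (fun i => r i ω) (fun i => hr1 i ω) (fun i => hr2 i ω)
  have hdisj : Disjoint (⋂ i, A i) (⋂ i, (A i)ᶜ) := by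
    refine Set.disjoint_left.2 fun ω h₁ h₂ => ?_
    obtain ⟨i⟩ := this
    exact Set.mem_iInter.1 h₂ i (Set.mem_iInter.1 h₁ i)
  have hcompl i : μ (A i)ᶜ = 1 / 2 := by
    rw [prob_compl_eq_one_sub (hAm i), hAp i, one_div, ENNReal.one_sub_inv_two]
  have hinter : μ (⋂ i, A i) = ∏ i, μ (A i) := by
    simpa using hAindep.meas_biInter Finset.univ
  rw [hset, measure_union hdisj (MeasurableSet.iInter fun i => (hAm i).compl), hinter,
    hAindep.measure_iInter_compl]
  simp only [hAp, hcompl, Finset.prod_const, Finset.card_univ, Fintype.card_fin]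
  rw [← two_mul, one_div, ← ENNReal.inv_pow, div_eq_mul_inv]
end

section
/- Fix a sequence l : ℕ → Fin 16 and, for a secret byte s and a plaintext f : ℕ → Fin 15 → BitVec 8, define the expanded blocks g(s, f) : ℕ → Fin 16 → BitVec 8 recursively by: g(s,f)(k)(j) = f(k)(j) for j ≤ 14, g(s,f)(0)(15) = s, and g(s,f)(k)(15) = g(s,f)(k−1)(l(k−1)) for k ≥ 1. Then for any two plaintexts f₀, f₁ and any two secret bytes s, s′, the XOR-differential of the expanded blocks is the same: for all k and j, g(s,f₀)(k)(j) XOR g(s,f₁)(k)(j) = g(s′,f₀)(k)(j) XOR g(s′,f₁)(k)(j). In particular, each expanded differential block is independent of the secret byte, and its byte at position 15 equals 0 when k = 0 and equals the differential byte g(s,f₀)(k−1)(l(k−1)) XOR g(s,f₁)(k−1)(l(k−1)) when k ≥ 1. -/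
/-- The data expansion of MCS: each 15-byte plain-block `f k` is expanded to 16 bytes by
appending the running variable `temp`, initialized to the secret byte `s` and updated to
the byte at pseudorandom position `l k` of the current expanded block. -/
def mcsExpand (l : ℕ → Fin 16) (s : BitVec 8) (f : ℕ → Fin 15 → BitVec 8) :
    ℕ → Fin 16 → BitVec 8
  | 0, j => if h : (j : ℕ) < 15 then f 0 ⟨j, h⟩ else s
  | k + 1, j => if h : (j : ℕ) < 15 then f (k + 1) ⟨j, h⟩ else mcsExpand l s f k (l k)

/-- The XOR-differential of the expanded blocks of two plaintexts is independent of the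
secret byte used for data expansion; moreover the differential byte at position 15 is `0`
in block `0` and equals the differential byte at position `l (k-1)` of block `k-1` for
`k ≥ 1`. -/
theorem expanded_differential_independent_of_secret
    (l : ℕ → Fin 16) (f₀ f₁ : ℕ → Fin 15 → BitVec 8) (s s' : BitVec 8) :
    (∀ k (j : Fin 16),
      mcsExpand l s f₀ k j ^^^ mcsExpand l s f₁ k j =
        mcsExpand l s' f₀ k j ^^^ mcsExpand l s' f₁ k j) ∧
    (mcsExpand l s f₀ 0 15 ^^^ mcsExpand l s f₁ 0 15 = 0) ∧
    (∀ k, 1 ≤ k →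
      mcsExpand l s f₀ k 15 ^^^ mcsExpand l s f₁ k 15 =
        mcsExpand l s f₀ (k - 1) (l (k - 1)) ^^^ mcsExpand l s f₁ (k - 1) (l (k - 1))) := by
  refine ⟨fun k => ?_, by simp [mcsExpand], fun k hk => ?_⟩
  · induction k with
    | zero => intro j; by_cases h : (j : ℕ) < 15 <;> simp [mcsExpand, h]
    | succ k ih =>
      intro j
      by_cases h : (j : ℕ) < 15
      · simp [mcsExpand, h]
      · simpa [mcsExpand, h] using ih (l k)
  · obtain ⟨k, rfl⟩ := Nat.exists_eq_add_of_le' hk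
    simp [mcsExpand]
end
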